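/- arXiv:1902.02431 — 2 statements merged into one kernel-verified Lean document; each statement's English description precedes it below -/
import Mathlib

section
/- Let k ≥ 1 and n₁, …, n_k ≥ 1. Consider a graph consisting of k internally disjoint paths between two terminals u and v, where path i has n_i edges and internal vertices v_{i,1}, …, v_{i,n_i−1} (with v_{i,0} = u and v_{i,n_i} = v). Let the spins X_u, X_v and X_{v_{i,j}} (1 ≤ i ≤ k, 1 ≤ j ≤ n_i−1) be i.i.d. uniform on {−1,+1}. For each edge (i,j) let S_{i,j} = X_{v_{i,j−1}}·X_{v_{i,j}}, and let the edge observations Y_{i,j} take values in finite sets and satisfy P((Y_{i,j})_{i,j} = (y_{i,j})_{i,j} | X) = Π_{i,j} q_{i,j}(y_{i,j}, S_{i,j}), where each q_{i,j}(·, s) is a probability mass function for s ∈ {−1,+1}. Then E[(E[X_u·X_v | all Y_{i,j}])²] ≤ Σ_{i=1}^k Π_{j=1}^{n_i} E[(E[S_{i,j} | Y_{i,j}])²]. -/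
open Finset
open scoped Classical

noncomputable section

/-- Probability of an event under the probability mass function `p` on `Ω`. -/
def pr {Ω : Type*} [Fintype Ω] (p : Ω → ℝ) (E : Ω → Prop) : ℝ :=
  ∑ ω ∈ Finset.univ.filter (fun ω => E ω), p ω

/-- Expectation of `f` under `p`. -/
def expec {Ω : Type*} [Fintype Ω] (p : Ω → ℝ) (f : Ω → ℝ) : ℝ :=
  ∑ ω, p ω * f ω

/-- The conditional expectation `E[U | A]`, as a random variable on `Ω`. -/
def condExp {Ω α : Type*} [Fintype Ω] (p : Ω → ℝ) (A : Ω → α) (U : Ω → ℝ) : Ω → ℝ :=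
  fun ω => expec p (fun ω' => if A ω' = A ω then U ω' else 0) / pr p (fun ω' => A ω' = A ω)

/-- The variance of `f` under `p`. -/
def var {Ω : Type*} [Fintype Ω] (p : Ω → ℝ) (f : Ω → ℝ) : ℝ :=
  expec p (fun ω => (f ω - expec p f)^2)

/-- The chi-squared mutual information `I2(A;B)`. -/
def I2 {Ω α β : Type*} [Fintype Ω] (p : Ω → ℝ) (A : Ω → α) (B : Ω → β) : ℝ :=
  ∑ a ∈ Finset.univ.image A, ∑ b ∈ Finset.univ.image B,
    if 0 < pr p (fun ω => A ω = a) * pr p (fun ω => B ω = b) then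
      (pr p (fun ω => A ω = a ∧ B ω = b) - pr p (fun ω => A ω = a) * pr p (fun ω => B ω = b))^2
        / (pr p (fun ω => A ω = a) * pr p (fun ω => B ω = b))
    else 0

/-- The spin at position `j` along a path with terminals carrying spins `xu`, `xv` and
internal spins `z 0, …, z (mi - 1)`: vertex `0` is the terminal `u`, vertex `mi + 1` is the
terminal `v`, and vertex `j` for `1 ≤ j ≤ mi` is the `(j-1)`-st internal vertex. -/
def chainVal (mi : ℕ) (xu xv : ℝ) (z : Fin mi → ℝ) (j : Fin (mi + 2)) : ℝ :=
  if _hj : (j : ℕ) = 0 then xu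
  else if _hj' : (j : ℕ) = mi + 1 then xv
  else z ⟨(j : ℕ) - 1, by omega⟩

/-- Sign of a boolean. -/
def sg (b : Bool) : ℝ := if b then 1 else -1

lemma sg_or (b : Bool) : sg b = 1 ∨ sg b = -1 := by cases b <;> simp [sg]

lemma sg_decide {x : ℝ} (hx : x = 1 ∨ x = -1) : sg (decide (x = 1)) = x := by
  rcases hx with h | h <;> subst h <;> norm_num [sg]

lemma sg_decide_iff {x : ℝ} (hx : x = 1 ∨ x = -1) (b : Bool) :
    decide (x = 1) = b ↔ x = sg b := by
  rcases hx with h | h <;> subst h <;> cases b <;> norm_num [sg]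

lemma sum_fiber {Ω C : Type*} [Fintype Ω] [Fintype C] (p : Ω → ℝ) (c : Ω → C) (G : C → ℝ) :
    ∑ ω, p ω * G (c ω) = ∑ x, pr p (fun ω => c ω = x) * G x := by
  rw [← Finset.sum_fiberwise Finset.univ c]
  refine Finset.sum_congr rfl fun x _ => ?_
  unfold pr
  rw [Finset.sum_mul]
  refine Finset.sum_congr (by ext; simp) fun ω hω => ?_
  simp only [Finset.mem_filter] at hω
  rw [hω.2]

lemma expec_sq {Ω α : Type*} [Fintype Ω] [Fintype α] (p : Ω → ℝ) (A : Ω → α) (U : Ω → ℝ) :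
    expec p (fun ω => (condExp p A U ω)^2)
      = ∑ a, (expec p (fun ω => if A ω = a then U ω else 0))^2 /
          expec p (fun ω => if A ω = a then 1 else 0) := by
  have h := sum_fiber p A (fun a => (expec p (fun ω' => if A ω' = a then U ω' else 0) /
    pr p (fun ω' => A ω' = a))^2)
  unfold condExp
  rw [expec, h]
  refine Finset.sum_congr rfl fun a _ => ?_
  have e : expec p (fun ω => if A ω = a then 1 else 0) = pr p (fun ω' => A ω' = a) := by
    unfold expec pr
    rw [Finset.sum_filter]
    simp
  rw [e]
  by_cases h0 : pr p (fun ω' => A ω' = a) = 0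
  · simp [h0]
  · field_simp

lemma chainVal_zero (n : ℕ) (xu xv : ℝ) (z : Fin n → ℝ) : chainVal n xu xv z 0 = xu := by
  simp [chainVal]

lemma chainVal_last (xu xv : ℝ) (z : Fin 0 → ℝ) : chainVal 0 xu xv z 1 = xv := by
  simp [chainVal]

lemma chainVal_succ (n : ℕ) (xu xv : ℝ) (z : Fin (n+1) → ℝ) (j : Fin (n+2)) :
    chainVal (n+1) xu xv z j.succ = chainVal n (z 0) xv (fun i => z i.succ) j := by
  unfold chainVal
  have hj := j.2
  by_cases h0 : (j : ℕ) = 0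
  · simp [h0]
  · by_cases h1 : (j : ℕ) = n + 1
    · simp [h1]
    · simp only [Fin.val_succ, Nat.add_eq_zero_iff, one_ne_zero, and_false, dite_false,
        Nat.add_right_cancel_iff, h0, h1]
      congr 1
      ext
      simp
      omega

lemma chainVal_or (n : ℕ) (xu xv : ℝ) (z : Fin n → ℝ) (hu : xu = 1 ∨ xu = -1)
    (hv : xv = 1 ∨ xv = -1) (hz : ∀ i, z i = 1 ∨ z i = -1) (j : Fin (n+2)) :
    chainVal n xu xv z j = 1 ∨ chainVal n xu xv z j = -1 := by
  unfold chainVal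
  split_ifs
  · exact hu
  · exact hv
  · exact hz _

lemma chain_sum (n : ℕ) : ∀ (xu xv : ℝ) (a b : Fin (n+1) → ℝ),
    ∑ z : Fin n → Bool, ∏ j : Fin (n+1), (a j +
      chainVal n xu xv (fun i => sg (z i)) j.castSucc *
        chainVal n xu xv (fun i => sg (z i)) j.succ * b j)
      = 2^n * (∏ j, a j + xu * xv * ∏ j, b j) := by
  induction n with
  | zero =>
    intro xu xv a b
    simp [chainVal]
  | succ n ih =>
    intro xu xv a b
    rw [← (Fin.consEquiv (fun _ : Fin (n+1) => Bool)).sum_comp, Fintype.sum_prod_type]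
    have key : ∀ z0 : Bool, ∑ z : Fin n → Bool, ∏ j : Fin (n+2), (a j +
      chainVal (n+1) xu xv (fun i => sg ((Fin.consEquiv (fun _ : Fin (n+1) => Bool)) (z0, z) i)) j.castSucc *
        chainVal (n+1) xu xv (fun i => sg ((Fin.consEquiv (fun _ : Fin (n+1) => Bool)) (z0, z) i)) j.succ * b j)
       = (a 0 + xu * sg z0 * b 0) *
          (2^n * (∏ j : Fin (n+1), a j.succ + sg z0 * xv * ∏ j : Fin (n+1), b j.succ)) := by
      intro z0
      rw [← ih, Finset.mul_sum]
      refine Finset.sum_congr rfl fun z _ => ?_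
      rw [Fin.prod_univ_succ]
      congr 1
      refine Finset.prod_congr rfl fun j _ => ?_
      rw [← Fin.succ_castSucc, chainVal_succ, chainVal_succ]
      simp [Fin.consEquiv]
    simp only [key, Fintype.sum_bool]
    rw [Fin.prod_univ_succ a, Fin.prod_univ_succ b]
    simp only [sg]
    norm_num
    ring

lemma law {Ω : Type*} [Fintype Ω] {k : ℕ}
    (m : Fin k → ℕ)
    {β : (i : Fin k) → Fin (m i + 1) → Type*} [∀ i j, Fintype (β i j)]
    (p : Ω → ℝ)
    (Xu Xv : Ω → ℝ) (Z : (i : Fin k) → Fin (m i) → Ω → ℝ)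
    (hXu : ∀ ω, Xu ω = 1 ∨ Xu ω = -1) (hXv : ∀ ω, Xv ω = 1 ∨ Xv ω = -1)
    (hZ : ∀ i j ω, Z i j ω = 1 ∨ Z i j ω = -1)
    (Y : (i : Fin k) → (j : Fin (m i + 1)) → Ω → β i j)
    (q : (i : Fin k) → (j : Fin (m i + 1)) → β i j → ℝ → ℝ)
    (hjoint : ∀ xu xv : ℝ, (xu = 1 ∨ xu = -1) → (xv = 1 ∨ xv = -1) →
      ∀ z : (i : Fin k) → Fin (m i) → ℝ, (∀ i j, z i j = 1 ∨ z i j = -1) →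
      ∀ y : (i : Fin k) → (j : Fin (m i + 1)) → β i j,
      pr p (fun ω => Xu ω = xu ∧ Xv ω = xv ∧ (∀ i j, Z i j ω = z i j) ∧
          (∀ i j, Y i j ω = y i j))
        = (1/2)^(2 + ∑ i, m i) *
          ∏ i, ∏ j, q i j (y i j)
            (chainVal (m i) xu xv (z i) j.castSucc * chainVal (m i) xu xv (z i) j.succ))
    (w : ℝ → ℝ) (h : (i : Fin k) → (j : Fin (m i + 1)) → β i j → ℝ → ℝ) :
    expec p (fun ω => w (Xu ω * Xv ω) * ∏ i, ∏ j, h i j (Y i j ω)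
      (chainVal (m i) (Xu ω) (Xv ω) (fun j' => Z i j' ω) j.castSucc *
            chainVal (m i) (Xu ω) (Xv ω) (fun j' => Z i j' ω) j.succ))
    = (w 1 * ∏ i, (∏ j, (∑ y, (q i j y 1 * h i j y 1 + q i j y (-1) * h i j y (-1)) / 2)
          + ∏ j, (∑ y, (q i j y 1 * h i j y 1 - q i j y (-1) * h i j y (-1)) / 2))
      + w (-1) * ∏ i, (∏ j, (∑ y, (q i j y 1 * h i j y 1 + q i j y (-1) * h i j y (-1)) / 2)
          - ∏ j, (∑ y, (q i j y 1 * h i j y 1 - q i j y (-1) * h i j y (-1)) / 2))) / 2 := by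
  set A : (i : Fin k) → Fin (m i + 1) → ℝ :=
    fun i j => ∑ y, (q i j y 1 * h i j y 1 + q i j y (-1) * h i j y (-1)) / 2 with hA
  set B : (i : Fin k) → Fin (m i + 1) → ℝ :=
    fun i j => ∑ y, (q i j y 1 * h i j y 1 - q i j y (-1) * h i j y (-1)) / 2 with hB
  let c : Ω → (Bool × Bool) × ((i : Fin k) → Fin (m i) → Bool) × ((i : Fin k) → (j : Fin (m i + 1)) → β i j) :=
    fun ω => ((decide (Xu ω = 1), decide (Xv ω = 1)), (fun i j => decide (Z i j ω = 1)),
      fun i j => Y i j ω)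
  let S : Bool → Bool → ((i : Fin k) → Fin (m i) → Bool) → (i : Fin k) → Fin (m i + 1) → ℝ :=
    fun u v z i j => chainVal (m i) (sg u) (sg v) (fun j' => sg (z i j')) j.castSucc *
            chainVal (m i) (sg u) (sg v) (fun j' => sg (z i j')) j.succ
  have hS : ∀ u v z i j, S u v z i j = 1 ∨ S u v z i j = -1 := by
    intro u v z i j
    rcases chainVal_or (m i) (sg u) (sg v) (fun j' => sg (z i j')) (sg_or u) (sg_or v)
      (fun _ => sg_or _) j.castSucc with h1 | h1 <;>
    rcases chainVal_or (m i) (sg u) (sg v) (fun j' => sg (z i j')) (sg_or u) (sg_or v)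
      (fun _ => sg_or _) j.succ with h2 | h2 <;> simp [S, h1, h2]
  have e1 := sum_fiber p c (fun x => w (sg x.1.1 * sg x.1.2) * ∏ i, ∏ j, h i j (x.2.2 i j)
    (S x.1.1 x.1.2 x.2.1 i j))
  have e2 : ∀ x, pr p (fun ω => c ω = x) = (1/2)^(2 + ∑ i, m i) *
      ∏ i, ∏ j, q i j (x.2.2 i j) (S x.1.1 x.1.2 x.2.1 i j) := by
    rintro ⟨⟨u, v⟩, z, y⟩
    rw [← hjoint (sg u) (sg v) (sg_or u) (sg_or v) (fun i j => sg (z i j)) (fun _ _ => sg_or _) y]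
    congr 1
    funext ω
    simp only [c, Prod.mk.injEq, funext_iff, sg_decide_iff (hXu ω), sg_decide_iff (hXv ω),
      sg_decide_iff (hZ _ _ ω), and_assoc]
  have e3 : expec p (fun ω => w (Xu ω * Xv ω) * ∏ i, ∏ j, h i j (Y i j ω)
      (chainVal (m i) (Xu ω) (Xv ω) (fun j' => Z i j' ω) j.castSucc *
            chainVal (m i) (Xu ω) (Xv ω) (fun j' => Z i j' ω) j.succ)) =
      ∑ ω, p ω * (fun x : (Bool × Bool) × ((i : Fin k) → Fin (m i) → Bool) × ((i : Fin k) → (j : Fin (m i + 1)) → β i j) => w (sg x.1.1 * sg x.1.2) * ∏ i, ∏ j, h i j (x.2.2 i j)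
    (S x.1.1 x.1.2 x.2.1 i j)) (c ω) := by
    unfold expec
    refine Finset.sum_congr rfl fun ω _ => ?_
    simp only [c, S, sg_decide (hXu ω), sg_decide (hXv ω), sg_decide (hZ _ _ ω)]
  rw [e3, e1]
  simp only [e2, Fintype.sum_prod_type]
  have e4 : ∀ u v z, ∑ y : ((i : Fin k) → (j : Fin (m i + 1)) → β i j),
      (1/2)^(2 + ∑ i, m i) * (∏ i, ∏ j, q i j (y i j) (S u v z i j)) *
        (w (sg u * sg v) * ∏ i, ∏ j, h i j (y i j) (S u v z i j))
      = (1/2)^(2 + ∑ i, m i) * w (sg u * sg v) *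
        ∏ i, ∏ j, (A i j + S u v z i j * B i j) := by
    intro u v z
    have : ∀ i j, A i j + S u v z i j * B i j
        = ∑ y, q i j y (S u v z i j) * h i j y (S u v z i j) := by
      intro i j
      simp only [hA, hB]
      rw [Finset.mul_sum, ← Finset.sum_add_distrib]
      refine Finset.sum_congr rfl fun y _ => ?_
      rcases hS u v z i j with h1 | h1 <;> rw [h1] <;> ring
    simp only [this]
    simp only [Finset.prod_univ_sum, Fintype.piFinset_univ]
    rw [Finset.mul_sum]
    refine Finset.sum_congr rfl fun y _ => ?_
    simp only [Finset.prod_mul_distrib]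
    ring
  have e5 : ∀ u v, ∑ z, (1/2)^(2 + ∑ i, m i) * w (sg u * sg v) *
        ∏ i, ∏ j, (A i j + S u v z i j * B i j)
      = (1/4) * w (sg u * sg v) * ∏ i, (∏ j, A i j + sg u * sg v * ∏ j, B i j) := by
    intro u v
    rw [← Finset.mul_sum]
    have := Finset.prod_univ_sum (fun i : Fin k => (Finset.univ : Finset (Fin (m i) → Bool)))
      (fun i z => ∏ j, (A i j + chainVal (m i) (sg u) (sg v) (fun j' => sg (z j')) j.castSucc *
            chainVal (m i) (sg u) (sg v) (fun j' => sg (z j')) j.succ * B i j))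
    rw [Fintype.piFinset_univ] at this
    simp only [S]
    rw [← this]
    simp only [chain_sum]
    rw [Finset.prod_mul_distrib, Finset.prod_pow_eq_pow_sum, pow_add, one_div, inv_pow, inv_pow]
    have : (2:ℝ)^(∑ i, m i) ≠ 0 := by positivity
    field_simp
    norm_num
    ring
  simp only [e4, e5, Fintype.sum_bool]
  simp only [sg]
  norm_num
  simp only [← sub_eq_add_neg]
  ring

lemma pt_ineq {P N P' N' : ℝ} (hP : 0 ≤ P) (hN : 0 ≤ N) (hP' : 0 ≤ P') (hN' : 0 ≤ N') :
    ((P * P' - N * N') / 2)^2 / ((P * P' + N * N') / 2) ≤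
      2 * (((P - N)/2) * ((P' - N')/2))
      + (((P - N)/2)^2 / ((P + N)/2)) * ((P' + N')/2)
      + ((P + N)/2) * (((P' - N')/2)^2 / ((P' + N')/2))
      - (((P - N)/2)^2 / ((P + N)/2)) * (((P' - N')/2)^2 / ((P' + N')/2))
      - (((P - N)/2)^3 / ((P + N)/2)^2) * ((P' - N')/2)
      - ((P - N)/2) * (((P' - N')/2)^3 / ((P' + N')/2)^2)
      + (((P - N)/2)^3 / ((P + N)/2)^2) * (((P' - N')/2)^3 / ((P' + N')/2)^2) := by
  obtain ⟨a, ha⟩ : ∃ a, a = (P + N)/2 := ⟨_, rfl⟩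
  obtain ⟨b, hb⟩ : ∃ b, b = (P - N)/2 := ⟨_, rfl⟩
  obtain ⟨a', ha'⟩ : ∃ a, a = (P' + N')/2 := ⟨_, rfl⟩
  obtain ⟨b', hb'⟩ : ∃ b, b = (P' - N')/2 := ⟨_, rfl⟩
  rcases eq_or_lt_of_le (show 0 ≤ a by rw [ha]; positivity) with h0 | h0
  · have h1 : P = 0 := by linarith
    have h2 : N = 0 := by linarith
    simp [h1, h2]
  rcases eq_or_lt_of_le (show 0 ≤ a' by rw [ha']; positivity) with h0' | h0'
  · have h1 : P' = 0 := by linarith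
    have h2 : N' = 0 := by linarith
    simp [h1, h2]
  have hs : (P * P' + N * N')/2 = a*a' + b*b' := by rw [ha,hb,ha',hb']; ring
  have hd : (P * P' - N * N')/2 = a*b' + b*a' := by rw [ha,hb,ha',hb']; ring
  have hpos : 0 ≤ a*a' + b*b' := by rw [← hs]; positivity
  rw [hs, hd, ← ha, ← hb, ← ha', ← hb']
  obtain ⟨r, hr⟩ : ∃ r, b = a * r := ⟨b / a, by field_simp⟩
  obtain ⟨s, hs'⟩ : ∃ s, b' = a' * s := ⟨b' / a', by field_simp⟩
  have hr2 : r^2 ≤ 1 := by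
    have : b^2 ≤ a^2 := by rw [ha, hb]; nlinarith [mul_nonneg hP hN]
    rw [hr, mul_pow] at this
    have := pow_pos h0 2
    by_contra hc
    nlinarith
  have hs2 : s^2 ≤ 1 := by
    have : b'^2 ≤ a'^2 := by rw [ha', hb']; nlinarith [mul_nonneg hP' hN']
    rw [hs', mul_pow] at this
    have := pow_pos h0' 2
    by_contra hc
    nlinarith
  have hfac : a*a' + b*b' = a*a'*(1+r*s) := by rw [hr, hs']; ring
  have hrs : 0 ≤ 1 + r*s := by
    rw [hfac] at hpos
    exact nonneg_of_mul_nonneg_right hpos (mul_pos h0 h0')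
  have R : (2 * (b * b') + (b^2 / a) * a' + a * (b'^2 / a') - (b^2 / a) * (b'^2 / a')
      - (b^3 / a^2) * b' - b * (b'^3 / a'^2) + (b^3 / a^2) * (b'^3 / a'^2))
      = a*a'*((1 + r*s) - (1-r^2)*(1-s^2)*(1-r*s)) := by
    rw [hr, hs']; field_simp; ring
  rw [R, hfac]
  have L : (a*b' + b*a')^2 / (a*a'*(1+r*s)) = a*a'*((r+s)^2/(1+r*s)) := by
    rw [hr, hs']
    rcases eq_or_lt_of_le hrs with h | h
    · simp [← h]
    · field_simp; ring
  rw [L]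
  refine mul_le_mul_of_nonneg_left ?_ (mul_pos h0 h0').le
  have hprod : 0 ≤ (1-r^2)*(1-s^2) := mul_nonneg (by linarith) (by linarith)
  rcases eq_or_lt_of_le hrs with h | h
  · rw [← h, div_zero]
    have : r*s = -1 := by linarith
    have h3 : r^2*s^2 = 1 := by rw [← mul_pow, this]; norm_num
    nlinarith [sq_nonneg r, sq_nonneg s]
  · rw [div_le_iff₀ h]
    nlinarith [mul_nonneg hprod (sq_nonneg (r*s))]

lemma two_sub {α α' : Type*} [Fintype α] [Fintype α'] (P N : α → ℝ) (P' N' : α' → ℝ)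
    (hP : ∀ x, 0 ≤ P x) (hN : ∀ x, 0 ≤ N x) (hP' : ∀ x, 0 ≤ P' x) (hN' : ∀ x, 0 ≤ N' x)
    (sP : ∑ x, P x = 1) (sN : ∑ x, N x = 1) (sP' : ∑ x, P' x = 1) (sN' : ∑ x, N' x = 1) :
    ∑ x, ∑ y, ((P x * P' y - N x * N' y) / 2)^2 / ((P x * P' y + N x * N' y) / 2) ≤
      ∑ x, ((P x - N x) / 2)^2 / ((P x + N x) / 2)
      + ∑ x, ((P' x - N' x) / 2)^2 / ((P' x + N' x) / 2) := by
  refine (Finset.sum_le_sum fun x _ => Finset.sum_le_sum fun y _ =>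
    pt_ineq (hP x) (hN x) (hP' y) (hN' y)).trans ?_
  simp only [Finset.sum_add_distrib, Finset.sum_sub_distrib, ← Finset.mul_sum, ← Finset.sum_mul]
  have hb : ∑ x, (P x - N x)/2 = 0 := by
    rw [← Finset.sum_div, Finset.sum_sub_distrib, sP, sN]; norm_num
  have hb' : ∑ x, (P' x - N' x)/2 = 0 := by
    rw [← Finset.sum_div, Finset.sum_sub_distrib, sP', sN']; norm_num
  have ha : ∑ x, (P x + N x)/2 = 1 := by
    rw [← Finset.sum_div, Finset.sum_add_distrib, sP, sN]; norm_num
  have ha' : ∑ x, (P' x + N' x)/2 = 1 := by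
    rw [← Finset.sum_div, Finset.sum_add_distrib, sP', sN']; norm_num
  have pt : ∀ P N : ℝ, 0 ≤ P → 0 ≤ N →
      |((P - N)/2)^3 / ((P + N)/2)^2| ≤ ((P - N) / 2)^2 / ((P + N) / 2) := by
    intro P N hP hN
    rcases eq_or_lt_of_le (show 0 ≤ (P+N)/2 by positivity) with h | h
    · simp [← h]
    have hle : |(P-N)/2| ≤ (P+N)/2 := abs_le.2 ⟨by linarith, by linarith⟩
    rw [abs_div, abs_pow, abs_of_pos (pow_pos h 2), div_le_div_iff₀ (pow_pos h 2) h,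
      ← sq_abs ((P-N)/2)]
    have := mul_le_mul_of_nonneg_left hle (mul_nonneg (sq_nonneg |(P-N)/2|) h.le)
    nlinarith
  have hd : |∑ x, ((P x - N x)/2)^3 / ((P x + N x)/2)^2| ≤
      ∑ x, ((P x - N x) / 2)^2 / ((P x + N x) / 2) :=
    (Finset.abs_sum_le_sum_abs _ _).trans
      (Finset.sum_le_sum fun x _ => pt _ _ (hP x) (hN x))
  have hd' : |∑ x, ((P' x - N' x)/2)^3 / ((P' x + N' x)/2)^2| ≤
      ∑ x, ((P' x - N' x) / 2)^2 / ((P' x + N' x) / 2) :=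
    (Finset.abs_sum_le_sum_abs _ _).trans
      (Finset.sum_le_sum fun x _ => pt _ _ (hP' x) (hN' x))
  have hm := mul_le_mul hd hd' (abs_nonneg _) ((abs_nonneg _).trans hd)
  rw [← abs_mul] at hm
  have hm' := (le_abs_self _).trans hm
  rw [hb, hb', ha, ha']
  linarith

lemma many_sub (k : ℕ) : ∀ (α : Fin k → Type*) [∀ i, Fintype (α i)] (P N : (i : Fin k) → α i → ℝ)
    (_ : ∀ i x, 0 ≤ P i x) (_ : ∀ i x, 0 ≤ N i x)
    (_ : ∀ i, ∑ x, P i x = 1) (_ : ∀ i, ∑ x, N i x = 1),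
    ∑ y : (i : Fin k) → α i, ((∏ i, P i (y i) - ∏ i, N i (y i)) / 2)^2 /
        ((∏ i, P i (y i) + ∏ i, N i (y i)) / 2) ≤
      ∑ i, ∑ x, ((P i x - N i x) / 2)^2 / ((P i x + N i x) / 2) := by
  induction k with
  | zero => intro α _ P N _ _ _ _; simp
  | succ k ih =>
    intro α _ P N hP hN sP sN
    rw [← (Fin.consEquiv α).sum_comp, Fintype.sum_prod_type, Fin.sum_univ_succ]
    have one : ∀ (R : (i : Fin (k+1)) → α i → ℝ), (∀ i, ∑ x, R i x = 1) →
        ∑ y : (i : Fin k) → α i.succ, ∏ i : Fin k, R i.succ (y i) = 1 := by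
      intro R hR
      have := Finset.prod_univ_sum (fun i : Fin k => (Finset.univ : Finset (α i.succ)))
        (fun i x => R i.succ x)
      rw [Fintype.piFinset_univ] at this
      rw [← this]
      simp [hR]
    have h2 := two_sub (P 0) (N 0) (fun y : (i : Fin k) → α i.succ => ∏ i : Fin k, P i.succ (y i))
      (fun y => ∏ i : Fin k, N i.succ (y i)) (hP 0) (hN 0)
      (fun y => Finset.prod_nonneg fun i _ => hP _ _) (fun y => Finset.prod_nonneg fun i _ => hN _ _)
      (sP 0) (sN 0) (one P sP) (one N sN)
    have h3 := ih (fun i => α i.succ) (fun i => P i.succ) (fun i => N i.succ)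
      (fun i => hP _) (fun i => hN _) (fun i => sP _) (fun i => sN _)
    simp only [Fin.prod_univ_succ, Fin.consEquiv, Equiv.coe_fn_mk, Fin.cons_zero, Fin.cons_succ]
    linarith

lemma edge_law {Ω : Type*} [Fintype Ω] {k : ℕ}
    (m : Fin k → ℕ)
    {β : (i : Fin k) → Fin (m i + 1) → Type*} [∀ i j, Fintype (β i j)]
    (p : Ω → ℝ)
    (Xu Xv : Ω → ℝ) (Z : (i : Fin k) → Fin (m i) → Ω → ℝ)
    (hXu : ∀ ω, Xu ω = 1 ∨ Xu ω = -1) (hXv : ∀ ω, Xv ω = 1 ∨ Xv ω = -1)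
    (hZ : ∀ i j ω, Z i j ω = 1 ∨ Z i j ω = -1)
    (Y : (i : Fin k) → (j : Fin (m i + 1)) → Ω → β i j)
    (q : (i : Fin k) → (j : Fin (m i + 1)) → β i j → ℝ → ℝ)
    (hq1 : ∀ i j s, (s = 1 ∨ s = -1) → ∑ y, q i j y s = 1)
    (hjoint : ∀ xu xv : ℝ, (xu = 1 ∨ xu = -1) → (xv = 1 ∨ xv = -1) →
      ∀ z : (i : Fin k) → Fin (m i) → ℝ, (∀ i j, z i j = 1 ∨ z i j = -1) →
      ∀ y : (i : Fin k) → (j : Fin (m i + 1)) → β i j,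
      pr p (fun ω => Xu ω = xu ∧ Xv ω = xv ∧ (∀ i j, Z i j ω = z i j) ∧
          (∀ i j, Y i j ω = y i j))
        = (1/2)^(2 + ∑ i, m i) *
          ∏ i, ∏ j, q i j (y i j)
            (chainVal (m i) xu xv (z i) j.castSucc * chainVal (m i) xu xv (z i) j.succ))
    (i₀ : Fin k) (j₀ : Fin (m i₀ + 1)) (y₀ : β i₀ j₀) (g : ℝ → ℝ) :
    expec p (fun ω => if Y i₀ j₀ ω = y₀ then
      g (chainVal (m i₀) (Xu ω) (Xv ω) (fun j' => Z i₀ j' ω) j₀.castSucc *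
            chainVal (m i₀) (Xu ω) (Xv ω) (fun j' => Z i₀ j' ω) j₀.succ) else 0)
    = (q i₀ j₀ y₀ 1 * g 1 + q i₀ j₀ y₀ (-1) * g (-1)) / 2 := by
  let h : (i : Fin k) → (j : Fin (m i + 1)) → β i j → ℝ → ℝ := fun i j y s =>
    if i = i₀ ∧ (j : ℕ) = (j₀ : ℕ) then (if y ≍ y₀ then g s else 0) else 1
  have hi : ∀ i, i ≠ i₀ → ∀ j y s, h i j y s = 1 := by
    intro i hi j y s; simp [h, hi]
  have hj : ∀ j, j ≠ j₀ → ∀ y s, h i₀ j y s = 1 := by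
    intro j hj y s
    have : (j : ℕ) ≠ (j₀ : ℕ) := fun e => hj (Fin.ext e)
    simp [h, this]
  have h0 : ∀ y s, h i₀ j₀ y s = if y = y₀ then g s else 0 := by
    intro y s; simp [h]
  have L := law m p Xu Xv Z hXu hXv hZ Y q hjoint (fun _ => 1) h
  have hA1 : ∀ i j, ∑ y, (q i j y 1 * 1 + q i j y (-1) * 1) / 2 = 1 := by
    intro i j
    rw [← Finset.sum_div]
    simp only [mul_one, Finset.sum_add_distrib]
    rw [hq1 i j 1 (Or.inl rfl), hq1 i j (-1) (Or.inr rfl)]; norm_num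
  have hB1 : ∀ i j, ∑ y, (q i j y 1 * 1 - q i j y (-1) * 1) / 2 = 0 := by
    intro i j
    rw [← Finset.sum_div]
    simp only [mul_one, Finset.sum_sub_distrib]
    rw [hq1 i j 1 (Or.inl rfl), hq1 i j (-1) (Or.inr rfl)]; norm_num
  have hl : ∀ ω, (1 * ∏ i, ∏ j, h i j (Y i j ω)
      (chainVal (m i) (Xu ω) (Xv ω) (fun j' => Z i j' ω) j.castSucc *
            chainVal (m i) (Xu ω) (Xv ω) (fun j' => Z i j' ω) j.succ)) =
      if Y i₀ j₀ ω = y₀ then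
      g (chainVal (m i₀) (Xu ω) (Xv ω) (fun j' => Z i₀ j' ω) j₀.castSucc *
            chainVal (m i₀) (Xu ω) (Xv ω) (fun j' => Z i₀ j' ω) j₀.succ) else 0 := by
    intro ω
    rw [one_mul, Finset.prod_eq_single i₀ (fun i _ hne => Finset.prod_eq_one fun j _ => hi i hne _ _ _)
      (by simp), Finset.prod_eq_single j₀ (fun j _ hne => hj j hne _ _) (by simp), h0]
  simp only [hl] at L
  rw [L]
  have h1 : ∀ i, i ≠ i₀ → ∏ j, (∑ y, (q i j y 1 * h i j y 1 + q i j y (-1) * h i j y (-1)) / 2) = 1 := by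
    intro i hne
    simp only [hi i hne, hA1, Finset.prod_const_one]
  have h2 : ∀ i, i ≠ i₀ → ∏ j, (∑ y, (q i j y 1 * h i j y 1 - q i j y (-1) * h i j y (-1)) / 2) = 0 := by
    intro i hne
    simp only [hi i hne, hB1, Finset.prod_const]
    simp
  have h3 : ∏ j, (∑ y, (q i₀ j y 1 * h i₀ j y 1 + q i₀ j y (-1) * h i₀ j y (-1)) / 2)
      = (q i₀ j₀ y₀ 1 * g 1 + q i₀ j₀ y₀ (-1) * g (-1)) / 2 := by
    rw [Finset.prod_eq_single j₀ (fun j _ hne => by simp only [hj j hne, hA1]) (by simp)]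
    rw [Finset.sum_eq_single y₀ (fun y _ hne => by simp [h0, hne]) (by simp)]
    simp [h0]
  rw [Finset.prod_eq_single i₀ (fun i _ hne => by rw [h1 i hne, h2 i hne, add_zero]) (by simp),
    Finset.prod_eq_single i₀ (fun i _ hne => by rw [h1 i hne, h2 i hne, sub_zero]) (by simp), h3]
  ring

/-- Subadditivity over paths of the chi-squared mutual information for a
spin synchronization model on a graph of `k ≥ 1` internally disjoint parallel paths between
two terminals `u`, `v`, where path `i` has `m i + 1` edges and internal vertices indexed by
`Fin (m i)`; edge `j` of path `i` joins vertices `j` and `j+1` of the chain, carries the edge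
spin `S i j` (product of adjacent spins), and is observed through an arbitrary channel `q i j`.
Then `E[(E[X_u·X_v | all Y])²] ≤ ∑ i, ∏ j, E[(E[S i j | Y i j])²]`. -/
theorem stmt7 {Ω : Type*} [Fintype Ω] {k : ℕ} (hk : 1 ≤ k)
    (m : Fin k → ℕ)
    {β : (i : Fin k) → Fin (m i + 1) → Type*} [∀ i j, Fintype (β i j)]
    (p : Ω → ℝ) (hp : ∀ ω, 0 ≤ p ω) (hps : ∑ ω, p ω = 1)
    (Xu Xv : Ω → ℝ) (Z : (i : Fin k) → Fin (m i) → Ω → ℝ)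
    (hXu : ∀ ω, Xu ω = 1 ∨ Xu ω = -1) (hXv : ∀ ω, Xv ω = 1 ∨ Xv ω = -1)
    (hZ : ∀ i j ω, Z i j ω = 1 ∨ Z i j ω = -1)
    (Y : (i : Fin k) → (j : Fin (m i + 1)) → Ω → β i j)
    (q : (i : Fin k) → (j : Fin (m i + 1)) → β i j → ℝ → ℝ)
    (hq0 : ∀ i j y s, (s = 1 ∨ s = -1) → 0 ≤ q i j y s)
    (hq1 : ∀ i j s, (s = 1 ∨ s = -1) → ∑ y, q i j y s = 1)
    (hjoint : ∀ xu xv : ℝ, (xu = 1 ∨ xu = -1) → (xv = 1 ∨ xv = -1) →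
      ∀ z : (i : Fin k) → Fin (m i) → ℝ, (∀ i j, z i j = 1 ∨ z i j = -1) →
      ∀ y : (i : Fin k) → (j : Fin (m i + 1)) → β i j,
      pr p (fun ω => Xu ω = xu ∧ Xv ω = xv ∧ (∀ i j, Z i j ω = z i j) ∧
          (∀ i j, Y i j ω = y i j))
        = (1/2)^(2 + ∑ i, m i) *
          ∏ i, ∏ j, q i j (y i j)
            (chainVal (m i) xu xv (z i) j.castSucc * chainVal (m i) xu xv (z i) j.succ)) :
    expec p (fun ω => (condExp p (fun ω' (i : Fin k) (j : Fin (m i + 1)) => Y i j ω')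
        (fun ω' => Xu ω' * Xv ω') ω)^2)
      ≤ ∑ i, ∏ j, expec p (fun ω => (condExp p (Y i j)
          (fun ω' => chainVal (m i) (Xu ω') (Xv ω') (fun j' => Z i j' ω') j.castSucc *
            chainVal (m i) (Xu ω') (Xv ω') (fun j' => Z i j' ω') j.succ) ω)^2) := by
  let a : (i : Fin k) → (j : Fin (m i + 1)) → β i j → ℝ := fun i j y => (q i j y 1 + q i j y (-1)) / 2
  let b : (i : Fin k) → (j : Fin (m i + 1)) → β i j → ℝ := fun i j y => (q i j y 1 - q i j y (-1)) / 2
  have sa : ∀ i j, ∑ y, a i j y = 1 := by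
    intro i j
    simp only [a]
    rw [← Finset.sum_div, Finset.sum_add_distrib, hq1 i j 1 (Or.inl rfl), hq1 i j (-1) (Or.inr rfl)]
    norm_num
  have sb : ∀ i j, ∑ y, b i j y = 0 := by
    intro i j
    simp only [b]
    rw [← Finset.sum_div, Finset.sum_sub_distrib, hq1 i j 1 (Or.inl rfl), hq1 i j (-1) (Or.inr rfl)]
    norm_num
  have hab : ∀ i j y, |b i j y| ≤ a i j y := by
    intro i j y
    have h1 := hq0 i j y 1 (Or.inl rfl)
    have h2 := hq0 i j y (-1) (Or.inr rfl)
    exact abs_le.2 ⟨by simp only [a, b]; linarith, by simp only [a, b]; linarith⟩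
  have habp : ∀ i (y : (j : Fin (m i + 1)) → β i j), |∏ j, b i j (y j)| ≤ ∏ j, a i j (y j) := by
    intro i y
    rw [Finset.abs_prod]
    exact Finset.prod_le_prod (fun _ _ => abs_nonneg _) fun j _ => hab i j _
  -- edge terms
  have edge : ∀ i j, expec p (fun ω => (condExp p (Y i j)
          (fun ω' => chainVal (m i) (Xu ω') (Xv ω') (fun j' => Z i j' ω') j.castSucc *
            chainVal (m i) (Xu ω') (Xv ω') (fun j' => Z i j' ω') j.succ) ω)^2)
      = ∑ y, (b i j y)^2 / a i j y := by
    intro i j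
    rw [expec_sq]
    refine Finset.sum_congr rfl fun y _ => ?_
    rw [edge_law m p Xu Xv Z hXu hXv hZ Y q hq1 hjoint i j y (fun s => s),
      edge_law m p Xu Xv Z hXu hXv hZ Y q hq1 hjoint i j y (fun _ => 1)]
    simp only [a, b]
    congr 2 <;> ring
  have full : ∀ (w : ℝ → ℝ) (y : (i : Fin k) → (j : Fin (m i + 1)) → β i j),
      expec p (fun ω => @ite ℝ ((fun (i : Fin k) (j : Fin (m i + 1)) => Y i j ω) = y)
        (Classical.propDecidable _) (w (Xu ω * Xv ω)) 0)
      = (w 1 * ∏ i, (∏ j, a i j (y i j) + ∏ j, b i j (y i j))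
        + w (-1) * ∏ i, (∏ j, a i j (y i j) - ∏ j, b i j (y i j))) / 2 := by
    intro w y
    have L := law m p Xu Xv Z hXu hXv hZ Y q hjoint w (fun i j y' _ => if y' = y i j then 1 else 0)
    have hA : ∀ i j, ∑ y', (q i j y' 1 * (if y' = y i j then 1 else 0) +
        q i j y' (-1) * (if y' = y i j then 1 else 0)) / 2 = a i j (y i j) := by
      intro i j
      rw [Finset.sum_eq_single (y i j) (fun y' _ hne => by simp [hne]) (by simp)]
      simp [a]
    have hB : ∀ i j, ∑ y', (q i j y' 1 * (if y' = y i j then 1 else 0) -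
        q i j y' (-1) * (if y' = y i j then 1 else 0)) / 2 = b i j (y i j) := by
      intro i j
      rw [Finset.sum_eq_single (y i j) (fun y' _ hne => by simp [hne]) (by simp)]
      simp [b]
    simp only [hA, hB] at L
    rw [← L]
    congr 1
    funext ω
    by_cases hy : (fun (i : Fin k) (j : Fin (m i + 1)) => Y i j ω) = y
    · subst hy; simp
    · rw [if_neg hy]
      have : ∃ i j, Y i j ω ≠ y i j := by
        by_contra hc
        push Not at hc
        exact hy (by funext i j; exact hc i j)
      obtain ⟨i, j, hij⟩ := this
      rw [Finset.prod_eq_zero (Finset.mem_univ i)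
        (Finset.prod_eq_zero (Finset.mem_univ j) (by simp [hij])), mul_zero]
  have M := many_sub k (fun i => (j : Fin (m i + 1)) → β i j)
    (fun i y => ∏ j, a i j (y j) + ∏ j, b i j (y j))
    (fun i y => ∏ j, a i j (y j) - ∏ j, b i j (y j))
    (fun i y => by linarith [(abs_le.1 (habp i y)).1])
    (fun i y => by linarith [(abs_le.1 (habp i y)).2])
    (fun i => by
      rw [Finset.sum_add_distrib, ← Fintype.piFinset_univ, ← Finset.prod_univ_sum,
        ← Finset.prod_univ_sum]
      simp [sa, sb])
    (fun i => by
      rw [Finset.sum_sub_distrib, ← Fintype.piFinset_univ, ← Finset.prod_univ_sum,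
        ← Finset.prod_univ_sum]
      simp [sa, sb])
  rw [expec_sq]
  simp only [edge]
  refine le_trans (le_of_eq ?_) (M.trans (le_of_eq ?_))
  · refine Finset.sum_congr rfl fun y _ => ?_
    rw [full (fun s => s) y, full (fun _ => 1) y]
    congr 2 <;> ring
  · refine Finset.sum_congr rfl fun i _ => ?_
    rw [Finset.prod_univ_sum, Fintype.piFinset_univ]
    refine Finset.sum_congr rfl fun y _ => ?_
    have e : ∏ j, (b i j (y j))^2 / a i j (y j) = (∏ j, b i j (y j))^2 / ∏ j, a i j (y j) := by
      rw [← Finset.prod_pow]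
      exact Finset.prod_div_distrib ..
    rw [e]
    congr 1
    · congr 1; ring
    · ring

end
end

section
/- Let T be a finite tree (a connected acyclic simple graph) with root ρ. Let σ_ρ be uniform on {−1,+1}, let (η_e)_{e ∈ E(T)} be independent of σ_ρ and of each other with P(η_e = −1) = ε_e ∈ [0,1], and for each vertex v set σ_v := σ_ρ · Π_{e ∈ path(ρ,v)} η_e, where path(ρ,v) is the edge set of the unique path from ρ to v in T. Then for every finite set of vertices W ⊆ V(T): E[(E[σ_ρ | (σ_w)_{w ∈ W}])²] ≤ Σ_{w ∈ W} E[(E[σ_ρ | σ_w])²], and moreover E[(E[σ_ρ | σ_w])²] = Π_{e ∈ path(ρ,w)} (1 − 2ε_e)² for each vertex w. -/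
open Finset
open scoped Classical

noncomputable section

/-- Tower property of `condExp`. -/
lemma tower {Ω α : Type*} [Fintype Ω] (p : Ω → ℝ) (hp : ∀ ω, 0 ≤ p ω)
    (A : Ω → α) (U f : Ω → ℝ) (hf : ∀ ω ω', A ω = A ω' → f ω = f ω') :
    ∑ ω, p ω * (condExp p A U ω * f ω) = ∑ ω, p ω * (U ω * f ω) := by
  have hm : ∀ ω ∈ (Finset.univ : Finset Ω), A ω ∈ Finset.univ.image A :=
    fun ω _ => Finset.mem_image_of_mem _ (Finset.mem_univ _)
  rw [← Finset.sum_fiberwise_of_maps_to hm, ← Finset.sum_fiberwise_of_maps_to hm]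
  refine Finset.sum_congr rfl fun a ha => ?_
  obtain ⟨ω0, -, rfl⟩ := Finset.mem_image.1 ha
  have e1 : ∑ ω ∈ Finset.univ.filter (fun ω => A ω = A ω0), p ω * (condExp p A U ω * f ω)
      = (∑ ω ∈ Finset.univ.filter (fun ω => A ω = A ω0), p ω) * (condExp p A U ω0 * f ω0) := by
    rw [Finset.sum_mul]
    refine Finset.sum_congr rfl fun ω hω => ?_
    have h : A ω = A ω0 := (Finset.mem_filter.1 hω).2
    rw [hf ω ω0 h]
    simp only [condExp, h]
  have e2 : ∑ ω ∈ Finset.univ.filter (fun ω => A ω = A ω0), p ω * (U ω * f ω)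
      = (∑ ω ∈ Finset.univ.filter (fun ω => A ω = A ω0), p ω * U ω) * f ω0 := by
    rw [Finset.sum_mul]
    refine Finset.sum_congr rfl fun ω hω => ?_
    have h : A ω = A ω0 := (Finset.mem_filter.1 hω).2
    rw [hf ω ω0 h]; ring
  have e3 : condExp p A U ω0 = (∑ ω ∈ Finset.univ.filter (fun ω => A ω = A ω0), p ω * U ω) /
      (∑ ω ∈ Finset.univ.filter (fun ω => A ω = A ω0), p ω) := by
    simp only [condExp, expec, pr, mul_ite, mul_zero, Finset.sum_filter]
  rw [e1, e2, e3]
  by_cases h0 : (∑ ω ∈ Finset.univ.filter (fun ω => A ω = A ω0), p ω) = 0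
  · have h1 := (Finset.sum_eq_zero_iff_of_nonneg (fun ω _ => hp ω)).1 h0
    have h2 : (∑ ω ∈ Finset.univ.filter (fun ω => A ω = A ω0), p ω * U ω) = 0 :=
      Finset.sum_eq_zero fun ω hω => by rw [h1 ω hω, zero_mul]
    rw [h0, h2]; simp
  · field_simp

lemma F_lower {Ω α : Type*} [Fintype Ω] (p : Ω → ℝ) (hp : ∀ ω, 0 ≤ p ω)
    (A : Ω → α) (U f : Ω → ℝ) (hf : ∀ ω ω', A ω = A ω' → f ω = f ω') :
    ∑ ω, p ω * (2 * (U ω * f ω) - f ω ^ 2) ≤ expec p (fun ω => (condExp p A U ω)^2) := by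
  have h := tower p hp A U f hf
  have e : ∑ ω, p ω * (2 * (U ω * f ω) - f ω ^ 2)
      = ∑ ω, p ω * (2 * (condExp p A U ω * f ω) - f ω ^ 2) := by
    have e1 : ∀ g : Ω → ℝ, ∑ ω, p ω * (2 * (g ω * f ω) - f ω ^ 2)
        = 2 * ∑ ω, p ω * (g ω * f ω) - ∑ ω, p ω * f ω ^ 2 := by
      intro g
      rw [Finset.mul_sum, ← Finset.sum_sub_distrib]
      exact Finset.sum_congr rfl fun ω _ => by ring
    rw [e1, e1, h]
  rw [e]
  refine Finset.sum_le_sum fun ω _ => mul_le_mul_of_nonneg_left ?_ (hp ω)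
  nlinarith [sq_nonneg (condExp p A U ω - f ω)]

lemma F_attained {Ω α : Type*} [Fintype Ω] (p : Ω → ℝ) (hp : ∀ ω, 0 ≤ p ω)
    (A : Ω → α) (U : Ω → ℝ) : ∃ f : Ω → ℝ, (∀ ω ω', A ω = A ω' → f ω = f ω') ∧
    expec p (fun ω => (condExp p A U ω)^2) = ∑ ω, p ω * (2 * (U ω * f ω) - f ω ^ 2) := by
  have hc : ∀ ω ω', A ω = A ω' → condExp p A U ω = condExp p A U ω' := by
    intro ω ω' h; simp only [condExp, h]
  refine ⟨condExp p A U, hc, ?_⟩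
  have h := tower p hp A U _ hc
  have e1 : ∑ ω, p ω * (2 * (U ω * condExp p A U ω) - condExp p A U ω ^ 2)
        = 2 * ∑ ω, p ω * (U ω * condExp p A U ω) - ∑ ω, p ω * condExp p A U ω ^ 2 := by
    rw [Finset.mul_sum, ← Finset.sum_sub_distrib]
    exact Finset.sum_congr rfl fun ω _ => by ring
  rw [e1, ← h]
  simp only [expec, ← pow_two]
  ring

/-- If a weighted identity holds on fibres of `A`, it holds against `A`-measurable functions. -/
lemma fiber_mul {Ω α : Type*} [Fintype Ω] (p : Ω → ℝ) (A : Ω → α) (X g : Ω → ℝ) (θ : ℝ)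
    (hX : ∀ ω ω', A ω = A ω' → X ω = X ω')
    (h : ∀ ω0, ∑ ω ∈ Finset.univ.filter (fun ω => A ω = A ω0), p ω * g ω
      = θ * ∑ ω ∈ Finset.univ.filter (fun ω => A ω = A ω0), p ω) :
    ∑ ω, p ω * (X ω * g ω) = θ * ∑ ω, p ω * X ω := by
  have hm : ∀ ω ∈ (Finset.univ : Finset Ω), A ω ∈ Finset.univ.image A :=
    fun ω _ => Finset.mem_image_of_mem _ (Finset.mem_univ _)
  rw [← Finset.sum_fiberwise_of_maps_to hm, ← Finset.sum_fiberwise_of_maps_to hm, Finset.mul_sum]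
  refine Finset.sum_congr rfl fun a ha => ?_
  obtain ⟨ω0, -, rfl⟩ := Finset.mem_image.1 ha
  trans X ω0 * ∑ ω ∈ Finset.univ.filter (fun ω => A ω = A ω0), p ω * g ω
  · rw [Finset.mul_sum]
    refine Finset.sum_congr rfl fun ω hω => ?_
    rw [hX ω ω0 (Finset.mem_filter.1 hω).2]; ring
  · rw [h ω0]
    trans θ * (X ω0 * ∑ ω ∈ Finset.univ.filter (fun ω => A ω = A ω0), p ω)
    · ring
    · congr 1
      rw [Finset.mul_sum]
      refine Finset.sum_congr rfl fun ω hω => ?_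
      rw [hX ω ω0 (Finset.mem_filter.1 hω).2]; ring

/-- Splitting a fibre sum of a sign. -/
lemma split_sign {Ω : Type*} [Fintype Ω] (p g : Ω → ℝ) (hg : ∀ ω, g ω = 1 ∨ g ω = -1)
    (E : Ω → Prop) :
    (∑ ω ∈ Finset.univ.filter (fun ω => E ω), p ω * g ω
      = pr p (fun ω => E ω ∧ g ω = 1) - pr p (fun ω => E ω ∧ g ω = -1)) ∧
    (∑ ω ∈ Finset.univ.filter (fun ω => E ω), p ω
      = pr p (fun ω => E ω ∧ g ω = 1) + pr p (fun ω => E ω ∧ g ω = -1)) := by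
  simp only [pr, Finset.sum_filter]
  rw [← Finset.sum_sub_distrib, ← Finset.sum_add_distrib]
  constructor
  all_goals
    refine Finset.sum_congr rfl fun ω _ => ?_
    by_cases hE : E ω
    · rcases hg ω with h | h <;> simp only [hE, h] <;> norm_num
    · simp [hE]

section model

variable {Ω K : Type*} [Fintype Ω]
    (p : Ω → ℝ) (σρ : Ω → ℝ) (η : K → Ω → ℝ) (D : Finset K) (ε : K → ℝ)

lemma ind_edge (hηr : ∀ e ∈ D, ∀ ω, η e ω = 1 ∨ η e ω = -1)
    (hσr : ∀ ω, σρ ω = 1 ∨ σρ ω = -1)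
    (hjoint : ∀ s : ℝ, (s = 1 ∨ s = -1) →
      ∀ z : K → ℝ, (∀ e ∈ D, z e = 1 ∨ z e = -1) →
      pr p (fun ω => σρ ω = s ∧ ∀ e ∈ D, η e ω = z e)
        = 1/2 * ∏ e ∈ D, (if z e = -1 then ε e else 1 - ε e))
    (e : K) (he : e ∈ D) (X : Ω → ℝ)
    (hX : ∀ ω ω', σρ ω = σρ ω' → (∀ e' ∈ D, e' ≠ e → η e' ω = η e' ω') → X ω = X ω') :
    ∑ ω, p ω * (X ω * η e ω) = (1 - 2 * ε e) * ∑ ω, p ω * X ω := by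
  refine fiber_mul p (fun ω => (σρ ω, fun e' : {x // x ∈ D ∧ x ≠ e} => η e'.1 ω)) X _ _ ?_ ?_
  · intro ω ω' h
    simp only [Prod.mk.injEq] at h
    refine hX ω ω' h.1 fun e' h1 h2 => congrFun h.2 ⟨e', h1, h2⟩
  · intro ω0
    obtain ⟨h1, h2⟩ := split_sign p (η e) (hηr e he)
      (fun ω => (σρ ω, fun e' : {x // x ∈ D ∧ x ≠ e} => η e'.1 ω) =
        (σρ ω0, fun e' : {x // x ∈ D ∧ x ≠ e} => η e'.1 ω0))
    have key : ∀ t : ℝ, (t = 1 ∨ t = -1) →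
        pr p (fun ω => (σρ ω, fun e' : {x // x ∈ D ∧ x ≠ e} => η e'.1 ω) =
        (σρ ω0, fun e' : {x // x ∈ D ∧ x ≠ e} => η e'.1 ω0) ∧ η e ω = t) =
        1/2 * ((if t = -1 then ε e else 1 - ε e) *
          ∏ e' ∈ D.erase e, (if η e' ω0 = -1 then ε e' else 1 - ε e')) := by
      intro t ht
      have hj := hjoint (σρ ω0) (hσr ω0) (fun x => if x = e then t else η x ω0) (by
        intro x hx
        by_cases hxe : x = e
        · simpa [hxe] using ht
        · simpa [hxe] using hηr x hx ω0)
      rw [← Finset.mul_prod_erase D _ he] at hj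
      have hE : (fun ω => (σρ ω, fun e' : {x // x ∈ D ∧ x ≠ e} => η e'.1 ω) =
        (σρ ω0, fun e' : {x // x ∈ D ∧ x ≠ e} => η e'.1 ω0) ∧ η e ω = t) =
        (fun ω => σρ ω = σρ ω0 ∧ ∀ e' ∈ D, η e' ω = if e' = e then t else η e' ω0) := by
        funext ω
        apply propext
        simp only [Prod.mk.injEq]
        constructor
        · rintro ⟨⟨a, b⟩, c⟩
          refine ⟨a, fun e' h' => ?_⟩
          by_cases hxe : e' = e
          · simpa [hxe] using c
          · simpa [hxe] using congrFun b ⟨e', h', hxe⟩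
        · rintro ⟨a, b⟩
          refine ⟨⟨a, ?_⟩, by simpa using b e he⟩
          funext x
          simpa [x.2.2] using b x.1 x.2.1
      rw [hE, hj]
      congr 2
      · simp
      · refine Finset.prod_congr rfl fun x hx => ?_
        simp [Finset.ne_of_mem_erase hx]
    rw [h1, h2, key 1 (Or.inl rfl), key (-1) (Or.inr rfl)]
    norm_num
    ring

lemma ind_root
    (hηr : ∀ e ∈ D, ∀ ω, η e ω = 1 ∨ η e ω = -1)
    (hσr : ∀ ω, σρ ω = 1 ∨ σρ ω = -1)
    (hjoint : ∀ s : ℝ, (s = 1 ∨ s = -1) →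
      ∀ z : K → ℝ, (∀ e ∈ D, z e = 1 ∨ z e = -1) →
      pr p (fun ω => σρ ω = s ∧ ∀ e ∈ D, η e ω = z e)
        = 1/2 * ∏ e ∈ D, (if z e = -1 then ε e else 1 - ε e)) :
    ∑ ω, p ω * σρ ω = 0 := by
  have := fiber_mul p (fun ω => (fun e' : {x // x ∈ D} => η e'.1 ω)) (fun _ => 1) σρ 0
    (fun _ _ _ => rfl) ?_
  · simpa using this
  · intro ω0
    obtain ⟨h1, h2⟩ := split_sign p σρ hσr
      (fun ω => (fun e' : {x // x ∈ D} => η e'.1 ω) = (fun e' : {x // x ∈ D} => η e'.1 ω0))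
    have key : ∀ t : ℝ, (t = 1 ∨ t = -1) →
        pr p (fun ω => (fun e' : {x // x ∈ D} => η e'.1 ω) =
          (fun e' : {x // x ∈ D} => η e'.1 ω0) ∧ σρ ω = t) =
        1/2 * (∏ e' ∈ D, (if η e' ω0 = -1 then ε e' else 1 - ε e')) := by
      intro t ht
      rw [← hjoint t ht (fun x => η x ω0) (fun x hx => hηr x hx ω0)]
      congr 1
      funext ω
      apply propext
      rw [and_comm, funext_iff]
      simp
    rw [h1, key 1 (Or.inl rfl), key (-1) (Or.inr rfl)]
    ring

lemma ind_prod (hηr : ∀ e ∈ D, ∀ ω, η e ω = 1 ∨ η e ω = -1)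
    (hσr : ∀ ω, σρ ω = 1 ∨ σρ ω = -1)
    (hjoint : ∀ s : ℝ, (s = 1 ∨ s = -1) →
      ∀ z : K → ℝ, (∀ e ∈ D, z e = 1 ∨ z e = -1) →
      pr p (fun ω => σρ ω = s ∧ ∀ e ∈ D, η e ω = z e)
        = 1/2 * ∏ e ∈ D, (if z e = -1 then ε e else 1 - ε e))
    (X : Ω → ℝ) (hX : ∀ ω ω', σρ ω = σρ ω' → X ω = X ω') (S : Finset K) (hS : S ⊆ D) :
    ∑ ω, p ω * (X ω * ∏ e ∈ S, η e ω) = (∏ e ∈ S, (1 - 2 * ε e)) * ∑ ω, p ω * X ω := by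
  induction S using Finset.induction_on with
  | empty => simp
  | insert e S he ih =>
    have h := ind_edge p σρ η D ε hηr hσr hjoint e (hS (Finset.mem_insert_self _ _))
      (fun ω => X ω * ∏ e ∈ S, η e ω) (by
        intro ω ω' h1 h2
        rw [hX ω ω' h1]
        congr 1
        refine Finset.prod_congr rfl fun x hx => h2 x (hS (Finset.mem_insert_of_mem hx)) ?_
        rintro rfl; exact he hx)
    rw [ih fun x hx => hS (Finset.mem_insert_of_mem hx)] at h
    rw [Finset.prod_insert he, mul_assoc, ← h]
    refine Finset.sum_congr rfl fun ω _ => ?_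
    rw [Finset.prod_insert he]; ring

/-- The one-edge contraction step. -/
lemma step_ineq {V : Type*} [DecidableEq V] (hp : ∀ ω, 0 ≤ p ω)
    (σ : V → Ω → ℝ) (W : Finset V) (u v : V) (ηe : Ω → ℝ) (θ : ℝ) (hθ : θ ^ 2 ≤ 1)
    (hη : ∀ ω, ηe ω = 1 ∨ ηe ω = -1) (hu : ∀ ω, σ u ω = 1 ∨ σ u ω = -1)
    (hv : ∀ ω, σ v ω = σ u ω * ηe ω)
    (hind : ∀ X : Ω → ℝ, (∀ ω ω', σρ ω = σρ ω' → (∀ w ∈ insert u W, σ w ω = σ w ω') →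
      X ω = X ω') → ∑ ω, p ω * (X ω * ηe ω) = θ * ∑ ω, p ω * X ω) :
    expec p (fun ω => (condExp p (fun ω' => fun w : {x // x ∈ insert v W} => σ w.1 ω') σρ ω)^2)
    ≤ (1 - θ ^ 2) *
      expec p (fun ω => (condExp p (fun ω' => fun w : {x // x ∈ W} => σ w.1 ω') σρ ω)^2)
    + θ ^ 2 * expec p (fun ω =>
        (condExp p (fun ω' => fun w : {x // x ∈ insert u W} => σ w.1 ω') σρ ω)^2) := by
  obtain ⟨f, hf, hF⟩ := F_attained p hp
    (fun ω' => fun w : {x // x ∈ insert v W} => σ w.1 ω') σρ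
  have hv1 : ∀ ω, σ v ω = 1 ∨ σ v ω = -1 := by
    intro ω; rw [hv]; rcases hη ω with h | h <;> rcases hu ω with h' | h' <;> simp [h, h']
  obtain ⟨G, hG⟩ := (Function.factorsThrough_iff (g := f)
    (f := fun ω => fun w : {x // x ∈ insert v W} => σ w.1 ω)).1 (fun ω ω' h => hf ω ω' h)
  let upd : ℝ → Ω → ({x // x ∈ insert v W} → ℝ) := fun t ω w => if w.1 = v then t else σ w.1 ω
  have hupd : ∀ t ω ω', (∀ w ∈ W, σ w ω = σ w ω') → upd t ω = upd t ω' := by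
    intro t ω ω' h
    funext w
    by_cases hw : w.1 = v
    · simp [upd, hw]
    · simp only [upd, hw, if_false]
      exact h _ (Finset.mem_of_mem_insert_of_ne w.2 hw)
  have hupd2 : ∀ t ω, σ v ω = t → f ω = G (upd t ω) := by
    intro t ω h
    rw [hG]
    simp only [Function.comp]
    congr 1
    funext w
    by_cases hw : w.1 = v
    · simp [upd, hw, h]
    · simp [upd, hw]
  obtain ⟨a, ha⟩ : ∃ a : Ω → ℝ, a = fun ω => (G (upd 1 ω) + G (upd (-1) ω)) / 2 := ⟨_, rfl⟩
  obtain ⟨b, hb⟩ : ∃ b : Ω → ℝ, b = fun ω => (G (upd 1 ω) - G (upd (-1) ω)) / 2 := ⟨_, rfl⟩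
  have haW : ∀ ω ω', (∀ w ∈ W, σ w ω = σ w ω') → a ω = a ω' := by
    intro ω ω' h; simp only [ha, hupd _ ω ω' h]
  have hbW : ∀ ω ω', (∀ w ∈ W, σ w ω = σ w ω') → b ω = b ω' := by
    intro ω ω' h; simp only [hb, hupd _ ω ω' h]
  have hfab : ∀ ω, f ω = a ω + b ω * (σ u ω * ηe ω) := by
    intro ω
    rw [← hv, ha, hb]
    rcases hv1 ω with h | h
    · rw [hupd2 _ ω h, h]; ring
    · rw [hupd2 _ ω h, h]; ring
  have hi := hind (fun ω => 2 * (σρ ω * b ω * σ u ω) - 2 * (a ω * b ω * σ u ω)) (by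
    intro ω ω' h1 h2
    have h3 : ∀ w ∈ W, σ w ω = σ w ω' := fun w hw => h2 w (Finset.mem_insert_of_mem hw)
    simp only [h1, haW ω ω' h3, hbW ω ω' h3, h2 u (Finset.mem_insert_self _ _)])
  have hFa : expec p (fun ω =>
        (condExp p (fun ω' => fun w : {x // x ∈ insert v W} => σ w.1 ω') σρ ω)^2)
      = ∑ ω, p ω * (2 * (σρ ω * a ω) - a ω ^ 2 - b ω ^ 2)
        + θ * ∑ ω, p ω * (2 * (σρ ω * b ω * σ u ω) - 2 * (a ω * b ω * σ u ω)) := by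
    rw [hF, ← hi, ← Finset.sum_add_distrib]
    refine Finset.sum_congr rfl fun ω _ => ?_
    rw [hfab]
    have h1 : ηe ω ^ 2 = 1 := by rcases hη ω with h | h <;> simp [h]
    have h2 : σ u ω ^ 2 = 1 := by rcases hu ω with h | h <;> simp [h]
    linear_combination (-p ω * b ω ^ 2 * σ u ω ^ 2) * h1 - p ω * b ω ^ 2 * h2
  rw [hFa]
  have hA := F_lower p hp (fun ω' => fun w : {x // x ∈ W} => σ w.1 ω') σρ a
    (fun ω ω' h => haW ω ω' fun w hw => congrFun h ⟨w, hw⟩)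
  by_cases h0 : θ = 0
  · subst h0
    simp only [zero_mul, add_zero]
    norm_num
    refine le_trans (Finset.sum_le_sum fun ω _ => mul_le_mul_of_nonneg_left ?_ (hp ω)) hA
    nlinarith [sq_nonneg (b ω)]
  · have hB := F_lower p hp (fun ω' => fun w : {x // x ∈ insert u W} => σ w.1 ω') σρ
      (fun ω => a ω + b ω * σ u ω / θ)
      (by
        intro ω ω' h
        have h2 : ∀ w ∈ insert u W, σ w ω = σ w ω' := fun w hw => congrFun h ⟨w, hw⟩
        have h3 : ∀ w ∈ W, σ w ω = σ w ω' := fun w hw => h2 w (Finset.mem_insert_of_mem hw)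
        simp only [haW ω ω' h3, hbW ω ω' h3, h2 u (Finset.mem_insert_self _ _)])
    refine le_trans (le_of_eq ?_) (add_le_add (mul_le_mul_of_nonneg_left hA (by linarith))
      (mul_le_mul_of_nonneg_left hB (sq_nonneg θ)))
    rw [Finset.mul_sum, Finset.mul_sum, Finset.mul_sum, ← Finset.sum_add_distrib,
      ← Finset.sum_add_distrib]
    refine Finset.sum_congr rfl fun ω _ => ?_
    have h2 : σ u ω ^ 2 = 1 := by rcases hu ω with h | h <;> simp [h]
    field_simp
    linear_combination (p ω * b ω ^ 2) * h2

lemma single_eq (hp : ∀ ω, 0 ≤ p ω) (hps : ∑ ω, p ω = 1) (Z : Ω → ℝ)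
    (hZ : ∀ ω, Z ω = 1 ∨ Z ω = -1) (c : ℝ)
    (h0 : ∑ ω, p ω * σρ ω = 0) (h1 : ∑ ω, p ω * Z ω = 0)
    (h2 : ∑ ω, p ω * (σρ ω * Z ω) = c) :
    expec p (fun ω => (condExp p Z σρ ω)^2) = c ^ 2 := by
  have calcv : ∀ a b : ℝ, ∑ ω, p ω * (2 * (σρ ω * (a + b * Z ω)) - (a + b * Z ω) ^ 2)
      = 2 * b * c - a ^ 2 - b ^ 2 := by
    intro a b
    have : ∀ ω, p ω * (2 * (σρ ω * (a + b * Z ω)) - (a + b * Z ω) ^ 2)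
      = 2 * a * (p ω * σρ ω) + 2 * b * (p ω * (σρ ω * Z ω)) - 2 * a * b * (p ω * Z ω)
        - (a ^ 2 + b ^ 2) * p ω := by
      intro ω
      have h2 : Z ω ^ 2 = 1 := by rcases hZ ω with h | h <;> simp [h]
      linear_combination (-p ω * b ^ 2) * h2
    simp only [this, Finset.sum_sub_distrib, Finset.sum_add_distrib, ← Finset.mul_sum,
      h0, h1, h2, hps]
    ring
  apply le_antisymm
  · obtain ⟨f, hf, hF⟩ := F_attained p hp Z σρ
    obtain ⟨G, hG⟩ := (Function.factorsThrough_iff (g := f) (f := Z)).1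
      (fun ω ω' h => hf ω ω' h)
    have hfab : ∀ ω, f ω = (G 1 + G (-1)) / 2 + (G 1 - G (-1)) / 2 * Z ω := by
      intro ω
      rw [hG, Function.comp]
      rcases hZ ω with h | h <;> rw [h] <;> ring
    rw [hF]
    simp only [hfab]
    rw [calcv]
    nlinarith [sq_nonneg ((G 1 - G (-1)) / 2 - c), sq_nonneg ((G 1 + G (-1)) / 2)]
  · have := F_lower p hp Z σρ (fun ω => 0 + c * Z ω) (fun ω ω' h => by simp only [h])
    rw [calcv] at this
    linarith

end model

/-- Structure of the paths from the root. -/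
lemma path_struct {V : Type*} [DecidableEq V]
    (G : SimpleGraph V) (hT : G.IsTree) (ρ : V)
    (pathE : V → Finset (Sym2 V))
    (hpath : ∀ v : V, ∃ w : G.Walk ρ v, w.IsPath ∧ pathE v = w.edges.toFinset)
    (v : V) (hv : v ≠ ρ) :
    ∃ u e, e ∈ G.edgeSet ∧ e ∉ pathE u ∧ pathE v = insert e (pathE u) ∧
      ∀ x, x ≠ v → (pathE x).card ≤ (pathE v).card → e ∉ pathE x := by
  have huniq : ∀ x (q : G.Walk ρ x), q.IsPath → pathE x = q.edges.toFinset := by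
    intro x q hq
    obtain ⟨w, hw, h⟩ := hpath x
    have hwq : w = q := congrArg Subtype.val
      ((hT.isAcyclic.subsingleton_path ρ x).elim (⟨w, hw⟩ : G.Path ρ x) ⟨q, hq⟩)
    rw [h, hwq]
  have hcard : ∀ x (q : G.Walk ρ x), q.IsPath → (pathE x).card = q.length := by
    intro x q hq
    rw [huniq x q hq, List.toFinset_card_of_nodup hq.isTrail.edges_nodup, q.length_edges]
  obtain ⟨w, hw, hwe⟩ := hpath v
  have hnil : ¬ w.Nil := SimpleGraph.Walk.not_nil_of_ne hv.symm
  have hconcat := w.concat_dropLast (w.adj_penultimate hnil)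
  have hd : w.dropLast.IsPath := by
    rw [← hconcat] at hw
    exact ((SimpleGraph.Walk.concat_isPath_iff _).1 hw).1
  have hedges : w.edges = w.dropLast.edges.concat s(w.penultimate, v) := by
    conv_lhs => rw [← hconcat]
    rw [SimpleGraph.Walk.edges_concat]
  have hlen : w.length = w.dropLast.length + 1 := by
    conv_lhs => rw [← hconcat]
    rw [SimpleGraph.Walk.length_concat]
  refine ⟨w.penultimate, s(w.penultimate, v), w.adj_penultimate hnil, ?_, ?_, ?_⟩
  · rw [huniq _ _ hd, List.mem_toFinset]
    have := hw.isTrail.edges_nodup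
    rw [hedges, List.concat_eq_append, List.nodup_append] at this
    intro hmem
    exact this.2.2 _ hmem _ (by simp) rfl
  · rw [huniq _ _ hd, hwe, hedges]
    ext y
    simp [or_comm]
  · intro x hx hle hmem
    obtain ⟨q, hq, hqe⟩ := hpath x
    rw [hqe, List.mem_toFinset] at hmem
    have hvq : v ∈ q.support := q.snd_mem_support_of_mem_edges hmem
    have h1 := hcard v _ (hq.takeUntil hvq)
    have h2 := hcard x q hq
    have h3 := q.length_takeUntil_lt_length hvq hx.symm
    omega

/-- chi-squared subadditivity for broadcasting on trees. On a finite tree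
`G` with root `ρ`, a uniform `{-1,+1}` root spin `σρ` is broadcast along the edges, each edge
`e` independently flipping the sign with probability `ε e`; `pathE v` is the edge set of the
unique path from `ρ` to `v`, and `σ v = σρ · ∏_{e ∈ pathE v} η e`. For every finite set of
vertices `W`, `E[(E[σρ | (σ_w)_{w ∈ W}])²] ≤ ∑_{w ∈ W} E[(E[σρ | σ_w])²]`, and moreover
`E[(E[σρ | σ_w])²] = ∏_{e ∈ pathE w} (1 − 2 ε e)²` for every vertex `w`. -/
theorem stmt17 {Ω V : Type*} [Fintype Ω] [Fintype V] [DecidableEq V]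
    (G : SimpleGraph V) [DecidableRel G.Adj] (hT : G.IsTree) (ρ : V)
    (pathE : V → Finset (Sym2 V))
    (hpath : ∀ v : V, ∃ w : G.Walk ρ v, w.IsPath ∧ pathE v = w.edges.toFinset)
    (p : Ω → ℝ) (hp : ∀ ω, 0 ≤ p ω) (hps : ∑ ω, p ω = 1)
    (σρ : Ω → ℝ) (η : Sym2 V → Ω → ℝ)
    (hσr : ∀ ω, σρ ω = 1 ∨ σρ ω = -1)
    (hηr : ∀ e ∈ G.edgeFinset, ∀ ω, η e ω = 1 ∨ η e ω = -1)
    (ε : Sym2 V → ℝ)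
    (hε0 : ∀ e ∈ G.edgeFinset, 0 ≤ ε e) (hε1 : ∀ e ∈ G.edgeFinset, ε e ≤ 1)
    (hjoint : ∀ s : ℝ, (s = 1 ∨ s = -1) →
      ∀ z : Sym2 V → ℝ, (∀ e ∈ G.edgeFinset, z e = 1 ∨ z e = -1) →
      pr p (fun ω => σρ ω = s ∧ ∀ e ∈ G.edgeFinset, η e ω = z e)
        = 1/2 * ∏ e ∈ G.edgeFinset, (if z e = -1 then ε e else 1 - ε e))
    (σ : V → Ω → ℝ)
    (hσdef : ∀ v ω, σ v ω = σρ ω * ∏ e ∈ pathE v, η e ω)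
    (W : Finset V) :
    expec p (fun ω => (condExp p (fun ω' => fun w : {x // x ∈ W} => σ w.1 ω') σρ ω)^2)
      ≤ ∑ w ∈ W, expec p (fun ω => (condExp p (σ w) σρ ω)^2) ∧
    ∀ w : V, expec p (fun ω => (condExp p (σ w) σρ ω)^2)
      = ∏ e ∈ pathE w, (1 - 2 * ε e)^2 := by
  have hsub : ∀ v, pathE v ⊆ G.edgeFinset := by
    intro v x hx
    obtain ⟨w, -, h⟩ := hpath v
    rw [h, List.mem_toFinset] at hx
    exact SimpleGraph.mem_edgeFinset.2 (w.edges_subset_edgeSet hx)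
  have hroot : pathE ρ = ∅ := by
    obtain ⟨w, hw, h⟩ := hpath ρ
    rw [SimpleGraph.Walk.isPath_iff_eq_nil] at hw
    rw [h, hw]; simp
  have hprod1 : ∀ v ω, (∏ e ∈ pathE v, η e ω) = 1 ∨ (∏ e ∈ pathE v, η e ω) = -1 := by
    intro v ω
    refine Finset.prod_induction _ (fun x : ℝ => x = 1 ∨ x = -1) ?_ (Or.inl rfl)
      (fun e he => hηr e (hsub v he) ω)
    rintro a b (rfl | rfl) (rfl | rfl) <;> norm_num
  have hσ1 : ∀ v ω, σ v ω = 1 ∨ σ v ω = -1 := by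
    intro v ω
    rw [hσdef]
    rcases hσr ω with h | h <;> rcases hprod1 v ω with h' | h' <;> rw [h, h'] <;> norm_num
  have hEr := ind_root p σρ η G.edgeFinset ε hηr hσr hjoint
  have hsingle : ∀ w : V, expec p (fun ω => (condExp p (σ w) σρ ω)^2)
      = ∏ e ∈ pathE w, (1 - 2 * ε e)^2 := by
    intro w
    rw [Finset.prod_pow]
    refine single_eq p σρ hp hps (σ w) (hσ1 w) _ hEr ?_ ?_
    · have h := ind_prod p σρ η G.edgeFinset ε hηr hσr hjoint σρ (fun _ _ h => h) _ (hsub w)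
      rw [hEr, mul_zero] at h
      simpa only [hσdef] using h
    · have h := ind_prod p σρ η G.edgeFinset ε hηr hσr hjoint (fun _ => 1)
        (fun _ _ _ => rfl) _ (hsub w)
      simp only [mul_one, hps, one_mul] at h
      rw [← h]
      refine Finset.sum_congr rfl fun ω _ => ?_
      rw [hσdef]
      have h2 : σρ ω ^ 2 = 1 := by rcases hσr ω with h | h <;> simp [h]
      linear_combination (p ω * ∏ e ∈ pathE w, η e ω) * h2
  refine ⟨?_, hsingle⟩
  simp only [hsingle]
  have hq : ∀ w, 0 ≤ ∏ e ∈ pathE w, (1 - 2 * ε e)^2 :=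
    fun w => Finset.prod_nonneg fun e _ => sq_nonneg _
  suffices H : ∀ n : ℕ, ∀ W : Finset V, ∑ w ∈ W, (pathE w).card = n →
      expec p (fun ω => (condExp p (fun ω' => fun w : {x // x ∈ W} => σ w.1 ω') σρ ω)^2)
        ≤ ∑ w ∈ W, ∏ e ∈ pathE w, (1 - 2 * ε e)^2 from H _ W rfl
  intro n
  induction n using Nat.strong_induction_on with
  | _ n ih =>
  intro W hW
  by_cases hρ : ρ ∈ W
  · refine le_trans ?_ (Finset.single_le_sum (fun w _ => hq w) hρ)
    rw [hroot, Finset.prod_empty]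
    obtain ⟨f, hf, hF⟩ := F_attained p hp (fun ω' => fun w : {x // x ∈ W} => σ w.1 ω') σρ
    rw [hF, ← hps]
    refine Finset.sum_le_sum fun ω _ => mul_le_of_le_one_right (hp ω) ?_
    have h2 : σρ ω ^ 2 = 1 := by rcases hσr ω with h | h <;> simp [h]
    nlinarith [sq_nonneg (σρ ω - f ω)]
  rcases W.eq_empty_or_nonempty with hWe | hWn
  · subst hWe
    obtain ⟨f, hf, hF⟩ := F_attained p hp
      (fun ω' => fun w : {x // x ∈ (∅ : Finset V)} => σ w.1 ω') σρ
    rw [hF, Finset.sum_empty]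
    have hc : ∀ ω ω', f ω = f ω' := fun ω ω' => hf ω ω' (funext fun w => absurd w.2 (Finset.notMem_empty _))
    rcases isEmpty_or_nonempty Ω with hO | ⟨⟨ω0⟩⟩
    · simp
    · have : ∀ ω, p ω * (2 * (σρ ω * f ω) - f ω ^ 2)
          = 2 * f ω0 * (p ω * σρ ω) - f ω0 ^ 2 * p ω := by
        intro ω; rw [hc ω ω0]; ring
      simp only [this, Finset.sum_sub_distrib, ← Finset.mul_sum, hEr, hps]
      nlinarith [sq_nonneg (f ω0)]
  obtain ⟨v, hvW, hmax⟩ := Finset.exists_max_image W (fun w => (pathE w).card) hWn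
  have hvρ : v ≠ ρ := by rintro rfl; exact hρ hvW
  obtain ⟨u, e, heG, heu, hev, hfar⟩ := path_struct G hT ρ pathE hpath v hvρ
  have heE : e ∈ G.edgeFinset := SimpleGraph.mem_edgeFinset.2 heG
  obtain ⟨W', hW'⟩ : ∃ W', W' = W.erase v := ⟨_, rfl⟩
  have hvW' : v ∉ W' := by simp [hW']
  have hins : W = insert v W' := by rw [hW', Finset.insert_erase hvW]
  have hcard : (pathE v).card = (pathE u).card + 1 := by
    rw [hev, Finset.card_insert_of_notMem heu]
  have hav : ∀ w ∈ insert u W', e ∉ pathE w := by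
    intro w hw
    rcases Finset.mem_insert.1 hw with rfl | hw
    · exact heu
    · refine hfar w ?_ (hmax w ?_)
      · rintro rfl; exact hvW' hw
      · rw [hins]; exact Finset.mem_insert_of_mem hw
  have hθ : (1 - 2 * ε e) ^ 2 ≤ 1 := by nlinarith [hε0 e heE, hε1 e heE]
  have hst := step_ineq p σρ hp σ W' u v (η e) (1 - 2 * ε e) hθ (hηr e heE) (hσ1 u)
    (by
      intro ω
      rw [hσdef, hσdef, hev, Finset.prod_insert heu]; ring)
    (by
      intro X hX
      refine ind_edge p σρ η G.edgeFinset ε hηr hσr hjoint e heE X fun ω ω' h1 h2 => ?_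
      refine hX ω ω' h1 fun w hw => ?_
      rw [hσdef, hσdef, h1]
      congr 1
      refine Finset.prod_congr rfl fun x hx => h2 x (hsub w hx) ?_
      rintro rfl
      exact hav w hw hx)
  have hsumW : ∑ w ∈ W, (pathE w).card = (pathE v).card + ∑ w ∈ W', (pathE w).card := by
    rw [hins, Finset.sum_insert hvW']
  have i1 := ih (∑ w ∈ W', (pathE w).card) (by omega) W' rfl
  have hle : ∑ w ∈ insert u W', (pathE w).card ≤ (pathE u).card + ∑ w ∈ W', (pathE w).card := by
    by_cases h : u ∈ W'
    · rw [Finset.insert_eq_of_mem h]; omega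
    · rw [Finset.sum_insert h]
  have i2 := ih (∑ w ∈ insert u W', (pathE w).card) (by omega) (insert u W') rfl
  have hle2 : ∑ w ∈ insert u W', ∏ e ∈ pathE w, (1 - 2 * ε e)^2
      ≤ (∏ e ∈ pathE u, (1 - 2 * ε e)^2) + ∑ w ∈ W', ∏ e ∈ pathE w, (1 - 2 * ε e)^2 := by
    by_cases h : u ∈ W'
    · rw [Finset.insert_eq_of_mem h]; linarith [hq u]
    · rw [Finset.sum_insert h]
  subst hins
  rw [Finset.sum_insert hvW', hev, Finset.prod_insert heu]
  refine le_trans hst ?_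
  have j1 := mul_le_mul_of_nonneg_left i1 (sub_nonneg.2 hθ)
  have j2 := mul_le_mul_of_nonneg_left (i2.trans hle2) (sq_nonneg (1 - 2 * ε e))
  linarith

end
end
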